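/- The degree sequence consisting of five 4's and one 2 (i.e., 4^5 2^1 on 6 vertices) is not planar graphical. -/

import Mathlib

/-- A simple graph is planar if it has a drawing in the plane: vertices are mapped
injectively to points, every edge is drawn as a simple arc between the images of its
endpoints, arcs pass through no vertex points other than their endpoints, and two arcs
of distinct edges meet only in common endpoints (no crossings). -/
def SimpleGraph.IsPlanar {V : Type*} (G : SimpleGraph V) : Prop :=
  ∃ (p : V → ℝ × ℝ) (a : ∀ u v, G.Adj u v → _root_.Path (p u) (p v)),
    Function.Injective p ∧
    (∀ u v (h : G.Adj u v), Function.Injective (a u v h)) ∧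
    (∀ u v (h : G.Adj u v) (w : V), p w ∈ Set.range (a u v h) → w = u ∨ w = v) ∧
    (∀ u v (h : G.Adj u v) u' v' (h' : G.Adj u' v'), s(u, v) ≠ s(u', v') →
      Set.range (a u v h) ∩ Set.range (a u' v' h') ⊆
        ({p u, p v} : Set (ℝ × ℝ)) ∩ ({p u', p v'} : Set (ℝ × ℝ)))

open unitInterval in
/-- The continuous curve `γ` has a continuous logarithm whose total increment is `d`. -/
def HasLogIncrement (γ : C(I, ℂ)) (d : ℂ) : Prop :=
  ∃ M : C(I, ℂ), (∀ t, Complex.exp (M t) = γ t) ∧ M 1 - M 0 = d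

namespace HasLogIncrement

open unitInterval

theorem exists_of_ne_zero (γ : C(I, ℂ)) (h : ∀ t, γ t ≠ 0) : ∃ d, HasLogIncrement γ d := by
  obtain ⟨M, hM, -⟩ := Complex.isCoveringMap_exp.exists_path_lifts
    ⟨fun t ↦ (⟨γ t, h t⟩ : {z : ℂ // z ≠ 0}), by fun_prop⟩ (Complex.log (γ 0))
    (Subtype.ext (Complex.exp_log (h 0)).symm)
  exact ⟨_, M, fun t ↦ congrArg Subtype.val (congrFun hM t), rfl⟩

theorem unique {γ : C(I, ℂ)} {d d' : ℂ} (h : HasLogIncrement γ d) (h' : HasLogIncrement γ d') :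
    d = d' := by
  obtain ⟨M, hM, rfl⟩ := h
  obtain ⟨M', hM', rfl⟩ := h'
  have h0 : Complex.exp (M 0 - M' 0) = 1 := by
    rw [Complex.exp_sub, hM, hM', div_self (hM 0 ▸ Complex.exp_ne_zero _)]
  have key : (M : I → ℂ) = fun t ↦ M' t + (M 0 - M' 0) := by
    refine Complex.isCoveringMap_exp.eq_of_comp_eq M.continuous (by fun_prop) ?_ 0 (by ring)
    funext t
    refine Subtype.ext ?_
    simp [Complex.exp_add, h0, hM, hM']
  have := congrFun key 1
  rw [this]; ring

theorem neg {γ : C(I, ℂ)} {d : ℂ} (h : HasLogIncrement γ d) : HasLogIncrement (-γ) d := by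
  obtain ⟨M, hM, rfl⟩ := h
  refine ⟨M + ContinuousMap.const _ (Real.pi * Complex.I), fun t ↦ ?_, by simp⟩
  simp [Complex.exp_add, hM]

theorem exp_mul {γ : C(I, ℂ)} {d : ℂ} (h : HasLogIncrement γ d) :
    Complex.exp d * γ 0 = γ 1 := by
  obtain ⟨M, hM, rfl⟩ := h
  rw [← hM, ← hM, ← Complex.exp_add]; ring_nf

/-- A nowhere vanishing function on the unit square has a continuous logarithm. -/
theorem exists_log_on_square (F : C(I × I, ℂ)) (h : ∀ x, F x ≠ 0) :
    ∃ L : C(I × I, ℂ), ∀ x, Complex.exp (L x) = F x := by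
  obtain ⟨_, M, hM, -⟩ := exists_of_ne_zero
    ⟨fun t ↦ F (0, t), by fun_prop⟩ (fun t ↦ h (0, t))
  let H : C(I × I, {z : ℂ // z ≠ 0}) := ⟨fun x ↦ ⟨F x, h x⟩, by fun_prop⟩
  have H0 : ∀ t, H (0, t) = ⟨_, Complex.exp_ne_zero (M t)⟩ := fun t ↦ Subtype.ext (hM t).symm
  exact ⟨Complex.isCoveringMap_exp.liftHomotopy H M H0, fun x ↦ congrArg Subtype.val
    (congrFun (Complex.isCoveringMap_exp.liftHomotopy_lifts H M H0) x)⟩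

/-- The total increment of the logarithm of `a s - b t` around the unit square is zero. -/
theorem add_eq_add_of_disjoint {a b : C(I, ℂ)} (hab : ∀ s t, a s ≠ b t) {A B C D : ℂ}
    (hA : HasLogIncrement (a - ContinuousMap.const _ (b 0)) A)
    (hB : HasLogIncrement (b - ContinuousMap.const _ (a 1)) B)
    (hC : HasLogIncrement (a - ContinuousMap.const _ (b 1)) C)
    (hD : HasLogIncrement (b - ContinuousMap.const _ (a 0)) D) :
    A + B = C + D := by
  obtain ⟨L, hL⟩ := exists_log_on_square ⟨fun x ↦ a x.1 - b x.2, by fun_prop⟩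
    (fun x ↦ sub_ne_zero.2 (hab _ _))
  have horizontal (t : I) : HasLogIncrement (a - ContinuousMap.const _ (b t))
      (L (1, t) - L (0, t)) :=
    ⟨⟨fun s ↦ L (s, t), by fun_prop⟩, fun s ↦ hL (s, t), rfl⟩
  have vertical (s : I) : HasLogIncrement (b - ContinuousMap.const _ (a s))
      (L (s, 1) - L (s, 0)) := by
    have : HasLogIncrement (ContinuousMap.const _ (a s) - b) (L (s, 1) - L (s, 0)) :=
      ⟨⟨fun t ↦ L (s, t), by fun_prop⟩, fun t ↦ hL (s, t), rfl⟩
    simpa using this.neg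
  rw [hA.unique (horizontal 0), hB.unique (vertical 1), hC.unique (horizontal 1),
    hD.unique (vertical 0)]
  ring

end HasLogIncrement

/-- Logarithms of the differences of a family of distinct complex numbers can be chosen so that
swapping the two points changes the logarithm by `π * I`. -/
theorem exists_log_sub {ι : Type*} [LinearOrder ι] (p : ι → ℂ) (hp : Function.Injective p) :
    ∃ θ : ι → ι → ℂ, (∀ i j, θ i j = θ j i) ∧ ∀ i j, i ≠ j →
      Complex.exp (θ i j + ((if j < i then 1 else 0 : ℤ) : ℂ) * (Real.pi * Complex.I)) =
        p i - p j := by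
  refine ⟨fun i j ↦ Complex.log (p (min i j) - p (max i j)), fun i j ↦ ?_, fun i j hij ↦ ?_⟩
  · simp [min_comm, max_comm]
  · have hij' : p i - p j ≠ 0 := sub_ne_zero.2 (hp.ne hij)
    have hji' : p j - p i ≠ 0 := sub_ne_zero.2 (hp.ne hij.symm)
    rcases lt_or_gt_of_ne hij with h | h
    · simp [h.le, not_lt.2 h.le, Complex.exp_log hij']
    · simp [h.le, h, Complex.exp_add, Complex.exp_log hji']

open unitInterval in
/-- **Van Kampen–Flores for `K₅`**: every continuous map of the complete graph on five vertices to
the plane identifies points of two disjoint edges. -/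
theorem exists_disjoint_edges_intersecting (p : Fin 5 → ℂ) (γ : Fin 5 → Fin 5 → C(I, ℂ))
    (h0 : ∀ i j, i < j → γ i j 0 = p i) (h1 : ∀ i j, i < j → γ i j 1 = p j) :
    ∃ i j k l, i < j ∧ k < l ∧ i ≠ k ∧ i ≠ l ∧ j ≠ k ∧ j ≠ l ∧ ∃ s t, γ i j s = γ k l t := by
  by_contra! hγ
  have avoid : ∀ i j k, i < j → k ≠ i → k ≠ j → ∀ t, γ i j t ≠ p k := by
    intro i j k hij hki hkj t
    obtain ⟨l, hli, hlj, hlk⟩ : ∃ l, l ≠ i ∧ l ≠ j ∧ l ≠ k := by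
      revert i j k; decide
    rcases lt_or_gt_of_ne hlk with h | h
    · rw [← h1 l k h]
      exact hγ i j l k hij h hli.symm hki.symm hlj.symm hkj.symm t 1
    · rw [← h0 k l h]
      exact hγ i j k l hij h hki.symm hli.symm hkj.symm hlj.symm t 0
  have hp : Function.Injective p := by
    intro i k hik
    by_contra hne
    obtain ⟨l, hli, hlk⟩ : ∃ l, l ≠ i ∧ l ≠ k := by
      clear hik; revert i k; decide
    rcases lt_or_gt_of_ne hli with h | h
    · exact avoid l i k h hlk.symm (Ne.symm hne) 1 (by rw [h1 l i h, hik])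
    · exact avoid i l k h (Ne.symm hne) hlk.symm 0 (by rw [h0 i l h, hik])
  obtain ⟨θ, hθ, hexp⟩ := exists_log_sub p hp
  let e (i j : Fin 5) : ℤ := if j < i then 1 else 0
  have hn : ∀ i j k, ∃ n : ℤ, i < j → k ≠ i → k ≠ j →
      HasLogIncrement (γ i j - ContinuousMap.const _ (p k))
        (θ j k - θ i k + (e j k - e i k + 2 * n : ℤ) * (Real.pi * Complex.I)) := by
    intro i j k
    by_cases h : i < j ∧ k ≠ i ∧ k ≠ j
    · obtain ⟨hij, hki, hkj⟩ := h
      obtain ⟨d, hd⟩ := HasLogIncrement.exists_of_ne_zero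
        (γ i j - ContinuousMap.const _ (p k)) (fun t ↦ sub_ne_zero.2 (avoid i j k hij hki hkj t))
      have hdexp := hd.exp_mul
      simp only [ContinuousMap.sub_apply, ContinuousMap.const_apply, h0 i j hij, h1 i j hij,
        ← hexp i k hki.symm, ← hexp j k hkj.symm, ← Complex.exp_add] at hdexp
      obtain ⟨n, hn⟩ := Complex.exp_eq_exp_iff_exists_int.1 hdexp
      refine ⟨n, fun _ _ _ ↦ ?_⟩
      convert hd using 1
      simp only [e]
      push_cast at hn ⊢
      linear_combination -hn
    · exact ⟨0, fun a b c ↦ (h ⟨a, b, c⟩).elim⟩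
  choose n hn using hn
  have square : ∀ i j k l, i < j → k < l → i ≠ k → i ≠ l → j ≠ k → j ≠ l →
      (e j k - e i k + 2 * n i j k) + (e l j - e k j + 2 * n k l j) =
        (e j l - e i l + 2 * n i j l) + (e l i - e k i + 2 * n k l i) := by
    intro i j k l hij hkl hik hil hjk hjl
    have := HasLogIncrement.add_eq_add_of_disjoint (hγ i j k l hij hkl hik hil hjk hjl)
      (by rw [h0 k l hkl]; exact hn i j k hij hik.symm hjk.symm)
      (by rw [h1 i j hij]; exact hn k l j hkl hjk hjl)
      (by rw [h1 k l hkl]; exact hn i j l hij hil.symm hjl.symm)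
      (by rw [h0 i j hij]; exact hn k l i hkl hik hil)
    rw [hθ l j, hθ k j, hθ l i, hθ k i] at this
    have hpi : (Real.pi * Complex.I : ℂ) ≠ 0 := by simp [Real.pi_ne_zero]
    rw [← Int.cast_inj (α := ℂ)]
    apply mul_right_cancel₀ hpi
    push_cast at this ⊢
    linear_combination this
  have separated : ∀ a b c d, a < b → b < c → c < d →
      n a b c + n c d b = n a b d + n c d a := by
    intro a b c d hab hbc hcd
    have := square a b c d hab hcd (by order) (by order) (by order) (by order)
    simp only [e] at this
    split_ifs at this <;> omega
  have nested : ∀ a b c d, a < b → b < c → c < d →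
      n a d b + n b c d = n a d c + n b c a := by
    intro a b c d hab hbc hcd
    have := square a d b c (by order) hbc (by order) (by order) (by order) (by order)
    simp only [e] at this
    split_ifs at this <;> omega
  have crossing : ∀ a b c d, a < b → b < c → c < d →
      n a c b + n b d c + 1 = n a c d + n b d a := by
    intro a b c d hab hbc hcd
    have := square a c b d (by order) (by order) (by order) (by order) (by order) (by order)
    simp only [e] at this
    split_ifs at this <;> omega
  have total : ∀ a b c d, a < b → b < c → c < d → ∃ m, 2 * m + 1 =
      n a b c + n c d b + n a b d + n c d a + n a d b + n b c d + n a d c + n b c a +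
      n a c b + n b d c + n a c d + n b d a := by
    intro a b c d hab hbc hcd
    have h1 := separated a b c d hab hbc hcd
    have h2 := nested a b c d hab hbc hcd
    have h3 := crossing a b c d hab hbc hcd
    exact ⟨n a b c + n c d b + n a d b + n b c d + n a c b + n b d c, by omega⟩
  obtain ⟨m₀, h₀⟩ := total 1 2 3 4 (by decide) (by decide) (by decide)
  obtain ⟨m₁, h₁⟩ := total 0 2 3 4 (by decide) (by decide) (by decide)
  obtain ⟨m₂, h₂⟩ := total 0 1 3 4 (by decide) (by decide) (by decide)
  obtain ⟨m₃, h₃⟩ := total 0 1 2 4 (by decide) (by decide) (by decide)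
  obtain ⟨m₄, h₄⟩ := total 0 1 2 3 (by decide) (by decide) (by decide)
  omega

open unitInterval in
/-- A planar graph contains no subdivision of `K₅` in which at most one edge is subdivided, and
that by a single vertex `w`. -/
theorem SimpleGraph.IsPlanar.not_subdivided_K5 {V : Type*} {G : SimpleGraph V} (hG : G.IsPlanar)
    (q : Fin 5 → V) (hq : Function.Injective q) (w : V) (hw : ∀ i, q i ≠ w)
    (h0 : G.Adj (q 0) w) (h1 : G.Adj w (q 1))
    (hadj : ∀ i j, i < j → ¬ (i = 0 ∧ j = 1) → G.Adj (q i) (q j)) : False := by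
  obtain ⟨p, a, hp, -, -, ha⟩ := hG
  let inEdge (i j : Fin 5) (u : V) : Prop := u = q i ∨ u = q j ∨ (u = w ∧ i = 0 ∧ j = 1)
  have hγ : ∀ i j, ∃ c : C(I, ℝ × ℝ), i < j → c 0 = p (q i) ∧ c 1 = p (q j) ∧
      ∀ s, ∃ u v, ∃ h : G.Adj u v, inEdge i j u ∧ inEdge i j v ∧ c s ∈ Set.range (a u v h) := by
    intro i j
    by_cases hij : i < j
    · by_cases h01 : i = 0 ∧ j = 1
      · obtain ⟨rfl, rfl⟩ := h01
        let c := (a _ _ h0).trans (a _ _ h1)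
        refine ⟨c.toContinuousMap, fun _ ↦ ⟨c.source, c.target, fun s ↦ ?_⟩⟩
        have hs : c s ∈ Set.range (a _ _ h0) ∪ Set.range (a _ _ h1) := by
          rw [← Path.trans_range]; exact ⟨s, rfl⟩
        rcases hs with hs | hs
        · exact ⟨_, _, h0, by simp [inEdge], by simp [inEdge], hs⟩
        · exact ⟨_, _, h1, by simp [inEdge], by simp [inEdge], hs⟩
      · let c := a _ _ (hadj i j hij h01)
        exact ⟨c.toContinuousMap, fun _ ↦ ⟨c.source, c.target, fun s ↦
          ⟨_, _, hadj i j hij h01, by simp [inEdge], by simp [inEdge], s, rfl⟩⟩⟩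
    · exact ⟨ContinuousMap.const _ 0, fun h ↦ (hij h).elim⟩
  choose c hc using hγ
  let φ := Complex.equivRealProdCLM.symm
  obtain ⟨i, j, k, l, hij, hkl, hik, hil, hjk, hjl, s, t, hst⟩ :=
    exists_disjoint_edges_intersecting (fun i ↦ φ (p (q i)))
      (fun i j ↦ ⟨fun t ↦ φ (c i j t), by fun_prop⟩)
      (fun i j h ↦ congrArg φ (hc i j h).1) (fun i j h ↦ congrArg φ (hc i j h).2.1)
  replace hst : c i j s = c k l t := φ.injective hst
  obtain ⟨u, v, huv, hu, hv, hs⟩ := (hc i j hij).2.2 s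
  obtain ⟨u', v', huv', hu', hv', ht⟩ := (hc k l hkl).2.2 t
  have hne : ∀ x y, inEdge i j x → inEdge k l y → x ≠ y := by
    rintro x y hx hy rfl
    rcases hx with rfl | rfl | ⟨rfl, rfl, rfl⟩ <;> rcases hy with h | h | ⟨h, rfl, rfl⟩ <;>
      first
        | exact hw _ h
        | exact hw _ h.symm
        | exact hik (hq h)
        | exact hil (hq h)
        | exact hjk (hq h)
        | exact hjl (hq h)
        | exact hik rfl
  have hss : s(u, v) ≠ s(u', v') := by
    intro h
    rcases Sym2.eq_iff.1 h with ⟨h, -⟩ | ⟨h, -⟩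
    · exact hne _ _ hu hu' h
    · exact hne _ _ hu hv' h
  obtain ⟨h, h'⟩ := ha u v huv u' v' huv' hss ⟨hs, hst ▸ ht⟩
  rcases h with h | h <;> rcases h' with h' | h'
  · exact hne _ _ hu hu' (hp (h.symm.trans h'))
  · exact hne _ _ hu hv' (hp (h.symm.trans h'))
  · exact hne _ _ hv hu' (hp (h.symm.trans h'))
  · exact hne _ _ hv hv' (hp (h.symm.trans h'))

/-- The degree sequence `4^5 2^1` (five 4's and one 2, on 6 vertices) is not
planar graphical: no simple planar graph has this degree sequence. -/
theorem seq_4_5_2_1_not_planar_graphical :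
    ¬ ∃ G : SimpleGraph (Fin 6), G.IsPlanar ∧
      Multiset.map (fun v => (G.neighborSet v).ncard) Finset.univ.val =
        Multiset.replicate 5 4 + Multiset.replicate 1 2 := by
  rintro ⟨G, hG, hdeg⟩
  obtain ⟨w, -, hw⟩ : ∃ w ∈ Finset.univ.val, (G.neighborSet w).ncard = 2 :=
    Multiset.mem_map.1 (by rw [hdeg]; simp)
  have hfour : ∀ v, v ≠ w → (G.neighborSet v).ncard = 4 := by
    have h : Multiset.map (fun v => (G.neighborSet v).ncard) (Finset.univ.erase w).val =
        Multiset.replicate 5 4 := by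
      rw [← Finset.insert_erase (Finset.mem_univ w),
        Finset.insert_val_of_notMem (Finset.notMem_erase w _), Multiset.map_cons, hw,
        Multiset.replicate_one, add_comm, Multiset.singleton_add, Multiset.cons_inj_right] at hdeg
      exact hdeg
    intro v hv
    exact Multiset.eq_of_mem_replicate (n := 5)
      (h ▸ Multiset.mem_map_of_mem _ (Finset.mem_erase.2 ⟨hv, Finset.mem_univ v⟩))
  obtain ⟨d, e, hde, hN⟩ := Set.ncard_eq_two.1 hw
  have hwadj : ∀ x, G.Adj w x ↔ x = d ∨ x = e := fun x ↦ by
    rw [← SimpleGraph.mem_neighborSet, hN]; simp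
  have hwd := (hwadj d).2 (.inl rfl)
  have hwe := (hwadj e).2 (.inr rfl)
  have hfull : ∀ x y, x ≠ w → x ≠ d → x ≠ e → y ≠ w → y ≠ x → G.Adj x y := by
    intro x y hxw hxd hxe hyw hyx
    have hsub : G.neighborSet x ⊆ ({w, x}ᶜ : Set (Fin 6)) := by
      intro z hz
      simp only [Set.mem_compl_iff, Set.mem_insert_iff, Set.mem_singleton_iff, not_or]
      refine ⟨?_, hz.ne'⟩
      rintro rfl
      exact ((hwadj x).1 hz.symm).elim hxd hxe
    have hcard : ({w, x}ᶜ : Set (Fin 6)).ncard = 4 := by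
      rw [Set.ncard_compl, Set.ncard_pair hxw.symm]; simp
    have heq := Set.eq_of_subset_of_ncard_le hsub (by rw [hcard, hfour x hxw])
    rw [← SimpleGraph.mem_neighborSet, heq]
    simp [hyw, hyx]
  obtain ⟨a, b, c, hab, hac, hbc, habc⟩ : ∃ a b c, a ≠ b ∧ a ≠ c ∧ b ≠ c ∧
      ({w, d, e}ᶜ : Finset (Fin 6)) = {a, b, c} := by
    refine Finset.card_eq_three.1 ?_
    rw [Finset.card_compl, Finset.card_eq_three.2 ⟨w, d, e, hwd.ne, hwe.ne, hde, rfl⟩]; simp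
  have hout : ∀ x, (x = a ∨ x = b ∨ x = c) → x ≠ w ∧ x ≠ d ∧ x ≠ e := by
    intro x hx
    have : x ∈ ({w, d, e}ᶜ : Finset (Fin 6)) := by rw [habc]; simpa using hx
    simpa using this
  obtain ⟨haw, had, hae⟩ := hout a (by simp)
  obtain ⟨hbw, hbd, hbe⟩ := hout b (by simp)
  obtain ⟨hcw, hcd, hce⟩ := hout c (by simp)
  refine hG.not_subdivided_K5 ![d, e, a, b, c] ?_ w ?_ hwd.symm hwe ?_
  · refine Function.Injective.of_lt_imp_ne fun i j hij ↦ ?_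
    fin_cases i <;> fin_cases j <;> first
      | exact absurd hij (by decide)
      | exact hde
      | exact had.symm
      | exact hbd.symm
      | exact hcd.symm
      | exact hae.symm
      | exact hbe.symm
      | exact hce.symm
      | exact hab
      | exact hac
      | exact hbc
  · intro i
    fin_cases i
    exacts [hwd.ne', hwe.ne', haw, hbw, hcw]
  · intro i j hij h01
    have hfull' : ∀ x y, x ≠ w → x ≠ d → x ≠ e → y ≠ w → y ≠ x → G.Adj y x :=
      fun x y h₁ h₂ h₃ h₄ h₅ ↦ (hfull x y h₁ h₂ h₃ h₄ h₅).symm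
    have hd := hwd.ne'
    have he := hwe.ne'
    fin_cases i <;> fin_cases j <;> first
      | exact absurd hij (by decide)
      | exact absurd ⟨rfl, rfl⟩ h01
      | (apply hfull' <;> first | assumption | (symm; assumption))
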